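/- arXiv:2008.06077 — 4 statements merged into one kernel-verified Lean document; each statement's English description precedes it below -/
import Mathlib

section
/- Let q₁, q₂ > 1 be integers. For every integer c, there exists a matrix γ = (a, b; cq₁q₂, d) ∈ Γ(q₁q₂) with lower-left entry equal to cq₁q₂ such that S_{χ₁,χ₂}(γ) = 0 for every pair of primitive Dirichlet characters χ₁ modulo q₁ and χ₂ modulo q₂ with χ₁(−1)χ₂(−1) = 1; that is, γ ∈ K¹_{q₁,q₂}. -/
open scoped MatrixGroups
open CongruenceSubgroup Matrix

/-- The first Bernoulli function `B₁(x)`: equal to `x - ⌊x⌋ - 1/2` for non-integral `x`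
and `0` for integral `x`. -/
noncomputable def B1 (x : ℝ) : ℝ := if Int.fract x = 0 then 0 else Int.fract x - 1/2

/-- The newform Dedekind sum `S_{χ₁,χ₂}(a, c)`. -/
noncomputable def ded {q₁ q₂ : ℕ} (χ₁ : DirichletCharacter ℂ q₁)
    (χ₂ : DirichletCharacter ℂ q₂) (a c : ℤ) : ℂ :=
  ∑ j ∈ Finset.range c.toNat, ∑ n ∈ Finset.range q₁,
    (starRingEnd ℂ) (χ₂ (j : ZMod q₂)) * (starRingEnd ℂ) (χ₁ (n : ZMod q₁)) *
      ((B1 ((j : ℝ) / (c : ℝ)) * B1 ((n : ℝ) / (q₁ : ℝ) + (a : ℝ) * (j : ℝ) / (c : ℝ)) : ℝ) : ℂ)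

/-- The newform Dedekind sum `S_{χ₁,χ₂}(γ)` of a matrix `γ`. -/
noncomputable def dedSL {q₁ q₂ : ℕ} (χ₁ : DirichletCharacter ℂ q₁)
    (χ₂ : DirichletCharacter ℂ q₂) (γ : SL(2, ℤ)) : ℂ :=
  if 0 < (γ : Matrix (Fin 2) (Fin 2) ℤ) 1 0 then
    ded χ₁ χ₂ ((γ : Matrix (Fin 2) (Fin 2) ℤ) 0 0) ((γ : Matrix (Fin 2) (Fin 2) ℤ) 1 0)
  else if (γ : Matrix (Fin 2) (Fin 2) ℤ) 1 0 < 0 then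
    ded χ₁ χ₂ (-(γ : Matrix (Fin 2) (Fin 2) ℤ) 0 0) (-(γ : Matrix (Fin 2) (Fin 2) ℤ) 1 0)
  else 0

lemma sum_range_mul_aux {M : Type*} [AddCommMonoid M] (q D : ℕ) (F : ℕ → M) :
    ∑ j ∈ Finset.range (q * D), F j
      = ∑ m ∈ Finset.range q, ∑ i ∈ Finset.range D, F (m * D + i) := by
  induction q with
  | zero => simp
  | succ k ih => rw [Nat.succ_mul, Finset.sum_range_add, ih, Finset.sum_range_succ]

lemma sum_range_zmod_aux {M : Type*} [AddCommMonoid M] (q : ℕ) [NeZero q] (F : ZMod q → M) :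
    ∑ n ∈ Finset.range q, F (n : ZMod q) = ∑ x : ZMod q, F x := by
  refine Finset.sum_bij' (fun n _ => (n : ZMod q)) (fun x _ => x.val) ?_ ?_ ?_ ?_ ?_
  · simp
  · intro x _
    simpa using ZMod.val_lt x
  · intro n hn
    exact ZMod.val_cast_of_lt (Finset.mem_range.mp hn)
  · intro x _
    simp
  · simp

lemma char_sum_aux {q : ℕ} (hq : 1 < q) (χ : DirichletCharacter ℂ q) (h : χ.IsPrimitive) :
    ∑ n ∈ Finset.range q, (starRingEnd ℂ) (χ (n : ZMod q)) = 0 := by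
  have : NeZero q := ⟨by omega⟩
  have hne : χ ≠ 1 := by
    rintro rfl
    have h1 := DirichletCharacter.conductor_one (R := ℂ) (n := q)
    have h2 : DirichletCharacter.conductor (1 : DirichletCharacter ℂ q) = q := h
    omega
  rw [← map_sum, sum_range_zmod_aux q (fun x => χ x), MulChar.sum_eq_zero_of_ne_one hne, map_zero]

lemma B1_neg_aux (x : ℝ) : B1 (-x) = - B1 x := by
  unfold B1
  by_cases h : Int.fract x = 0
  · have h' : Int.fract (-x) = 0 := Int.fract_neg_eq_zero.mpr h
    simp [h, h']
  · have h' : Int.fract (-x) ≠ 0 := fun h2 => h (Int.fract_neg_eq_zero.mp h2)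
    rw [if_neg h, if_neg h', Int.fract_neg h]
    ring

lemma B1_shift_aux (q : ℕ) (hq : 0 < q) (k : ℤ) (t : ℝ) (h0 : 0 < t) (h1 : t < 1 / q) :
    B1 ((k : ℝ) / q + t) = (((k : ZMod q).val : ℝ) / q - 1 / 2) + t := by
  have : NeZero q := ⟨by omega⟩
  have hqr : (0 : ℝ) < q := by exact_mod_cast hq
  have hv : (((k : ZMod q).val : ℤ)) = k % q := ZMod.val_intCast k
  have hk : (k : ℝ) = ((k : ZMod q).val : ℝ) + q * ((k / q : ℤ) : ℝ) := by
    have := Int.emod_add_mul_ediv k q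
    rw [← hv] at this
    exact_mod_cast this.symm
  have hlt : ((k : ZMod q).val : ℝ) + 1 ≤ q := by
    exact_mod_cast ZMod.val_lt (k : ZMod q)
  set v : ℝ := ((k : ZMod q).val : ℝ) with hvdef
  have hv0 : 0 ≤ v := Nat.cast_nonneg _
  have hx : (k : ℝ) / q + t = (v / q + t) + ((k / q : ℤ) : ℝ) := by
    rw [hk]; field_simp; ring
  have hf : Int.fract ((k : ℝ) / q + t) = v / q + t := by
    rw [hx, Int.fract_add_intCast, Int.fract_eq_self]
    refine ⟨by positivity, ?_⟩
    have : (v + 1) / q ≤ 1 := by rw [div_le_one hqr]; exact hlt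
    rw [add_div] at this
    linarith
  have hpos : 0 < v / q + t := by positivity
  unfold B1
  rw [hf, if_neg hpos.ne']
  ring

/-- Uniform description of the second Bernoulli factor for slope `s = ±1`. -/
lemma B1_sign_aux (q : ℕ) (hq : 0 < q) (s : ℤ) (hs : s = 1 ∨ s = -1) :
    ∃ h : ZMod q → ℝ, ∀ (k : ℤ) (t : ℝ), 0 < t → t < 1 / q →
      B1 ((k : ℝ) / q + s * t) = h (k : ZMod q) + s * t := by
  rcases hs with rfl | rfl
  · refine ⟨fun x => (x.val : ℝ) / q - 1 / 2, fun k t h0 h1 => ?_⟩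
    simpa using B1_shift_aux q hq k t h0 h1
  · refine ⟨fun x => -(((-x).val : ℝ) / q - 1 / 2), fun k t h0 h1 => ?_⟩
    have := B1_shift_aux q hq (-k) t h0 h1
    have e : (k : ℝ) / q + ((-1 : ℤ) : ℝ) * t = -(((-k : ℤ) : ℝ) / q + t) := by
      push_cast; ring
    rw [e, B1_neg_aux, this]
    push_cast; ring

lemma ded_zero_aux {q₁ q₂ : ℕ} (hq₁ : 1 < q₁) (hq₂ : 1 < q₂) (χ₁ : DirichletCharacter ℂ q₁)
    (χ₂ : DirichletCharacter ℂ q₂) (h₁ : χ₁.IsPrimitive) (h₂ : χ₂.IsPrimitive)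
    (s : ℤ) (hs : s = 1 ∨ s = -1) (c : ℕ) (hc : 0 < c) :
    ded χ₁ χ₂ s ((q₁ * (c * q₂) : ℕ) : ℤ) = 0 := by
  have : NeZero q₁ := ⟨by omega⟩
  have : NeZero q₂ := ⟨by omega⟩
  obtain ⟨h, hh⟩ := B1_sign_aux q₁ (by omega) s hs
  have hS1 := char_sum_aux hq₁ χ₁ h₁
  have hS2 := char_sum_aux hq₂ χ₂ h₂
  set D := c * q₂ with hD
  have hDpos : 0 < D := by positivity
  have hDr : (0 : ℝ) < D := by exact_mod_cast hDpos
  have hqr : (0 : ℝ) < q₁ := by exact_mod_cast (by omega : 0 < q₁)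
  -- the constant
  set K : ℂ := ∑ m ∈ Finset.range q₁, ∑ n ∈ Finset.range q₁,
    (starRingEnd ℂ) (χ₁ (n : ZMod q₁)) *
      (((m : ℝ) / q₁ * h ((n : ZMod q₁) + (s : ZMod q₁) * (m : ZMod q₁)) : ℝ) : ℂ) with hK
  set H : ℂ := ∑ x : ZMod q₁, (h x : ℂ) with hH
  have hsum : ∀ n : ZMod q₁, ∑ m ∈ Finset.range q₁,
      (h (n + (s : ZMod q₁) * (m : ZMod q₁)) : ℂ) = H := by
    intro n
    rw [sum_range_zmod_aux q₁ (fun x => (h (n + (s : ZMod q₁) * x) : ℂ)), hH]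
    refine Fintype.sum_bijective (fun x : ZMod q₁ => n + (s : ZMod q₁) * x) ?_ _ _ (fun x => rfl)
    rcases hs with rfl | rfl
    · simpa using (Equiv.addLeft n).bijective
    · have := (Equiv.subLeft n).bijective
      simpa [sub_eq_add_neg] using this
  unfold ded
  rw [Int.toNat_natCast, sum_range_mul_aux, Finset.sum_comm]
  have key : ∀ i ∈ Finset.range D, ∑ m ∈ Finset.range q₁, ∑ n ∈ Finset.range q₁,
      (starRingEnd ℂ) (χ₂ ((m * D + i : ℕ) : ZMod q₂)) * (starRingEnd ℂ) (χ₁ (n : ZMod q₁)) *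
      ((B1 (((m * D + i : ℕ) : ℝ) / (((q₁ * D : ℕ) : ℤ) : ℝ)) *
        B1 ((n : ℝ) / (q₁ : ℝ) + (s : ℝ) * ((m * D + i : ℕ) : ℝ) /
          (((q₁ * D : ℕ) : ℤ) : ℝ)) : ℝ) : ℂ)
      = (starRingEnd ℂ) (χ₂ (i : ZMod q₂)) * K := by
    intro i hi
    have hi' : i < D := Finset.mem_range.mp hi
    have hcast : ∀ m : ℕ, ((m * D + i : ℕ) : ZMod q₂) = (i : ZMod q₂) := by
      intro m; simp [hD]
    simp_rw [hcast]
    rcases Nat.eq_zero_or_pos i with rfl | hipos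
    · have : χ₂ ((0 : ℕ) : ZMod q₂) = 0 := by
        have : Fact (1 < q₂) := ⟨hq₂⟩
        rw [Nat.cast_zero]
        exact MulChar.map_zero χ₂
      simp only [this, map_zero, zero_mul, Finset.sum_const_zero]
    have hir : (0 : ℝ) < i := by exact_mod_cast hipos
    have hir' : (i : ℝ) < D := by exact_mod_cast hi'
    set t : ℝ := (i : ℝ) / (q₁ * D) with ht
    have ht0 : 0 < t := by positivity
    have ht1 : t < 1 / q₁ := by
      rw [ht, div_lt_div_iff₀ (by positivity) hqr]
      nlinarith
    have e1 : ∀ m ∈ Finset.range q₁,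
        B1 (((m * D + i : ℕ) : ℝ) / (((q₁ * D : ℕ) : ℤ) : ℝ)) = (m : ℝ) / q₁ + (t - 1 / 2) := by
      intro m hm
      have := B1_shift_aux q₁ (by omega) (m : ℤ) t ht0 ht1
      rw [Int.cast_natCast, Int.cast_natCast, ZMod.val_cast_of_lt (Finset.mem_range.mp hm)] at this
      have e : ((m * D + i : ℕ) : ℝ) / (((q₁ * D : ℕ) : ℤ) : ℝ) = (m : ℝ) / q₁ + t := by
        rw [ht]; push_cast; field_simp
      rw [e, this]; ring
    have e2 : ∀ m n : ℕ, B1 ((n : ℝ) / (q₁ : ℝ) + (s : ℝ) * ((m * D + i : ℕ) : ℝ) /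
          (((q₁ * D : ℕ) : ℤ) : ℝ)) = h ((n : ZMod q₁) + (s : ZMod q₁) * (m : ZMod q₁)) + s * t := by
      intro m n
      have := hh ((n : ℤ) + s * m) t ht0 ht1
      push_cast at this
      rw [← this]
      congr 1
      rw [ht]; push_cast; field_simp; ring
    have e3 : ∀ m ∈ Finset.range q₁, ∑ n ∈ Finset.range q₁,
      (starRingEnd ℂ) (χ₂ (i : ZMod q₂)) * (starRingEnd ℂ) (χ₁ (n : ZMod q₁)) *
      ((B1 (((m * D + i : ℕ) : ℝ) / (((q₁ * D : ℕ) : ℤ) : ℝ)) *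
        B1 ((n : ℝ) / (q₁ : ℝ) + (s : ℝ) * ((m * D + i : ℕ) : ℝ) /
          (((q₁ * D : ℕ) : ℤ) : ℝ)) : ℝ) : ℂ) =
      (starRingEnd ℂ) (χ₂ (i : ZMod q₂)) * (∑ n ∈ Finset.range q₁,
        (starRingEnd ℂ) (χ₁ (n : ZMod q₁)) *
        (((m : ℝ) / q₁ * h ((n : ZMod q₁) + (s : ZMod q₁) * (m : ZMod q₁)) : ℝ) : ℂ)
        + ((t - 1 / 2 : ℝ) : ℂ) * ∑ n ∈ Finset.range q₁, (starRingEnd ℂ) (χ₁ (n : ZMod q₁)) *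
          (h ((n : ZMod q₁) + (s : ZMod q₁) * (m : ZMod q₁)) : ℂ)
        + (((m : ℝ) / q₁ + (t - 1 / 2)) * (s * t) : ℝ) *
          ∑ n ∈ Finset.range q₁, (starRingEnd ℂ) (χ₁ (n : ZMod q₁))) := by
      intro m hm
      rw [e1 m hm]
      simp_rw [e2]
      rw [Finset.mul_sum, Finset.mul_sum, ← Finset.sum_add_distrib, ← Finset.sum_add_distrib,
        Finset.mul_sum]
      refine Finset.sum_congr rfl fun n _ => ?_
      push_cast
      ring
    rw [Finset.sum_congr rfl e3, ← Finset.mul_sum, hS1]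
    simp only [mul_zero, add_zero]
    rw [Finset.sum_add_distrib, ← hK, ← Finset.mul_sum, Finset.sum_comm]
    simp_rw [← Finset.mul_sum, hsum]
    rw [← Finset.sum_mul, hS1]
    simp
  rw [Finset.sum_congr rfl key, ← Finset.sum_mul, hD, sum_range_mul_aux]
  have : ∀ m i : ℕ, ((m * q₂ + i : ℕ) : ZMod q₂) = (i : ZMod q₂) := by
    intro m i; simp
  simp_rw [this, hS2]
  simp

/-- The kernel is strongly nontrivial: for every `c` there is `γ ∈ Γ(q₁q₂)` with
lower-left entry `c·q₁q₂` killed by every newform Dedekind sum of conductors `q₁, q₂`. -/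
theorem kernel_is_strongly_nontrivial {q₁ q₂ : ℕ} (hq₁ : 1 < q₁) (hq₂ : 1 < q₂) (c : ℤ) :
    ∃ γ : SL(2, ℤ), γ ∈ Gamma (q₁ * q₂) ∧
      (γ : Matrix (Fin 2) (Fin 2) ℤ) 1 0 = c * ((q₁ * q₂ : ℕ) : ℤ) ∧
      ∀ (χ₁ : DirichletCharacter ℂ q₁) (χ₂ : DirichletCharacter ℂ q₂),
        χ₁.IsPrimitive → χ₂.IsPrimitive → χ₁ (-1) * χ₂ (-1) = 1 →
          dedSL χ₁ χ₂ γ = 0 := by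
  refine ⟨⟨!![1, 0; c * ((q₁ * q₂ : ℕ) : ℤ), 1], by simp [Matrix.det_fin_two]⟩, ?_, by simp, ?_⟩
  · refine Gamma_mem.mpr ?_
    refine ⟨by simp, by simp, ?_, by simp⟩
    have : ((c * ((q₁ * q₂ : ℕ) : ℤ) : ℤ) : ZMod (q₁ * q₂)) = 0 := by
      rw [Int.cast_mul, Int.cast_natCast, ZMod.natCast_self, mul_zero]
    simpa using this
  · intro χ₁ χ₂ h₁ h₂ _
    unfold dedSL
    have a1 : (!![1, 0; c * ((q₁ * q₂ : ℕ) : ℤ), 1] : Matrix (Fin 2) (Fin 2) ℤ) 1 0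
      = c * ((q₁ * q₂ : ℕ) : ℤ) := by simp
    have a0 : (!![1, 0; c * ((q₁ * q₂ : ℕ) : ℤ), 1] : Matrix (Fin 2) (Fin 2) ℤ) 0 0 = 1 := by simp
    simp only [a1, a0]
    have hN : (0 : ℤ) < ((q₁ * q₂ : ℕ) : ℤ) := by
      have : 0 < q₁ * q₂ := by positivity
      exact_mod_cast this
    split_ifs with hp hn
    · have hc : 0 < c := pos_of_mul_pos_left hp hN.le
      lift c to ℕ using hc.le
      have := ded_zero_aux hq₁ hq₂ χ₁ χ₂ h₁ h₂ 1 (Or.inl rfl) c (by exact_mod_cast hc)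
      convert this using 1
      congr 1
      push_cast; ring
    · have hc : 0 < -c := by
        by_contra hcon
        have : 0 ≤ c := by omega
        nlinarith
      obtain ⟨k, hk⟩ := Int.eq_ofNat_of_zero_le hc.le
      have := ded_zero_aux hq₁ hq₂ χ₁ χ₂ h₁ h₂ (-1) (Or.inr rfl) k (by omega)
      convert this using 1
      congr 1
      have : c = -(k : ℤ) := by omega
      rw [this]
      push_cast; ring
    · rfl
end

section
/- The image {S_{χ₁,χ₂}(γ) : γ ∈ Γ₁(q₁q₂)} is an infinite subset of ℂ; in particular, the kernel K¹_{χ₁,χ₂} = {γ ∈ Γ₁(q₁q₂) : S_{χ₁,χ₂}(γ) = 0} has infinite index in Γ₁(q₁q₂). -/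
open scoped MatrixGroups
open CongruenceSubgroup Matrix

lemma aux_sum_range_zmod {q : ℕ} [NeZero q] (g : ZMod q → ℂ) :
    ∑ n ∈ Finset.range q, g (n : ZMod q) = ∑ x : ZMod q, g x := by
  refine Finset.sum_bij' (fun n _ => (n : ZMod q)) (fun x _ => x.val) ?_ ?_ ?_ ?_ ?_
  · intro a _; exact Finset.mem_univ _
  · intro a _; exact Finset.mem_range.2 (ZMod.val_lt a)
  · intro a ha; exact ZMod.val_cast_of_lt (Finset.mem_range.1 ha)
  · intro a _; simp
  · intro a _; rfl

lemma aux_prim_inv {q : ℕ} {χ : DirichletCharacter ℂ q} (h : χ.IsPrimitive) :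
    (χ⁻¹).IsPrimitive := by
  rw [DirichletCharacter.isPrimitive_def] at *
  rw [DirichletCharacter.conductor_inv, h]

lemma aux_gauss_ne {q : ℕ} [NeZero q] {χ : DirichletCharacter ℂ q} (h : χ.IsPrimitive) :
    gaussSum χ (ZMod.stdAddChar (N := q)) ≠ 0 := by
  intro h0
  have : ZMod.dft (fun x => χ x) = 0 := by
    ext k
    have := gaussSum_mulShift_of_isPrimitive (ZMod.stdAddChar (N := q)) h (-k)
    rw [h0, mul_zero] at this
    rw [ZMod.dft_apply, Pi.zero_apply, ← this]
    simp only [gaussSum, AddChar.mulShift_apply, smul_eq_mul]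
    refine Finset.sum_congr rfl fun x _ => ?_
    rw [mul_comm (χ x)]
    congr 2; ring
  have h2 := (LinearEquiv.map_eq_zero_iff _).1 this
  have := congrFun h2 1
  simp at this

lemma aux_gauss_sum {q : ℕ} [NeZero q] {χ : DirichletCharacter ℂ q} (h : χ.IsPrimitive) (a : ZMod q) :
    ∑ n ∈ Finset.range q, (starRingEnd ℂ) (χ (n : ZMod q)) * ZMod.stdAddChar (a * (n : ZMod q))
      = χ a * gaussSum χ⁻¹ (ZMod.stdAddChar (N := q)) := by
  rw [aux_sum_range_zmod (fun x => (starRingEnd ℂ) (χ x) * ZMod.stdAddChar (a * x))]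
  have := gaussSum_mulShift_of_isPrimitive (ZMod.stdAddChar (N := q)) (aux_prim_inv h) a
  rw [inv_inv] at this
  rw [← this, gaussSum]
  refine Finset.sum_congr rfl fun x _ => ?_
  rw [AddChar.mulShift_apply, ← MulChar.star_apply']
  rfl

lemma aux_fourier {q₁ q₂ : ℕ} [NeZero q₁] [NeZero q₂] (m ε : ℤ) (n u : ℕ) :
    fourier m ((Int.fract ((n : ℝ) / q₁ + ε * u / q₂) : ℝ) : UnitAddCircle) =
      ZMod.stdAddChar ((m : ZMod q₁) * (n : ZMod q₁)) *
        ZMod.stdAddChar (((m * ε : ℤ) : ZMod q₂) * (u : ZMod q₂)) := by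
  have e1 : ((m : ZMod q₁) * (n : ZMod q₁)) = ((m * n : ℤ) : ZMod q₁) := by push_cast; rfl
  have e2 : (((m * ε : ℤ) : ZMod q₂) * (u : ZMod q₂)) = ((m * ε * u : ℤ) : ZMod q₂) := by
    push_cast; rfl
  have hq1 : (q₁ : ℂ) ≠ 0 := by exact_mod_cast NeZero.ne q₁
  have hq2 : (q₂ : ℂ) ≠ 0 := by exact_mod_cast NeZero.ne q₂
  rw [e1, e2, ZMod.stdAddChar_coe, ZMod.stdAddChar_coe, ← Complex.exp_add, fourier_coe_apply,
    Complex.exp_eq_exp_iff_exists_int]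
  refine ⟨-(m * ⌊(n : ℝ) / q₁ + ε * u / q₂⌋), ?_⟩
  rw [Int.fract]
  push_cast
  field_simp
  ring

lemma aux_double {q₁ q₂ : ℕ} [NeZero q₁] [NeZero q₂]
    {χ₁ : DirichletCharacter ℂ q₁} {χ₂ : DirichletCharacter ℂ q₂}
    (h₁ : χ₁.IsPrimitive) (h₂ : χ₂.IsPrimitive) (m ε : ℤ) :
    ∑ u ∈ Finset.range q₂, ∑ n ∈ Finset.range q₁,
      (starRingEnd ℂ) (χ₂ (u : ZMod q₂)) * (starRingEnd ℂ) (χ₁ (n : ZMod q₁)) *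
      fourier m ((Int.fract ((n : ℝ) / q₁ + ε * u / q₂) : ℝ) : UnitAddCircle) =
    χ₁ m * χ₂ m * (χ₂ ε * gaussSum χ₁⁻¹ ZMod.stdAddChar * gaussSum χ₂⁻¹ ZMod.stdAddChar) := by
  have e1 := aux_gauss_sum h₁ (m : ZMod q₁)
  have e2 := aux_gauss_sum h₂ ((m * ε : ℤ) : ZMod q₂)
  have : χ₁ m * χ₂ m * (χ₂ ε * gaussSum χ₁⁻¹ ZMod.stdAddChar * gaussSum χ₂⁻¹ ZMod.stdAddChar) =
     (χ₂ ((m * ε : ℤ) : ZMod q₂) * gaussSum χ₂⁻¹ ZMod.stdAddChar) * 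
     (χ₁ m * gaussSum χ₁⁻¹ ZMod.stdAddChar) := by
    push_cast; rw [map_mul]; ring
  rw [this, ← e1, ← e2, Finset.sum_mul_sum]
  refine Finset.sum_congr rfl fun u _ => Finset.sum_congr rfl fun n _ => ?_
  rw [aux_fourier]; ring

lemma aux_L_ne {q₁ q₂ : ℕ} [NeZero q₁] [NeZero q₂]
    (χ₁ : DirichletCharacter ℂ q₁) (χ₂ : DirichletCharacter ℂ q₂) (A : ℂ)
    (hA : HasSum (fun m : ℕ => 1 / (m : ℂ) ^ 2 * (χ₁ m * χ₂ m)) A) : A ≠ 0 := by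
  let ψ : DirichletCharacter ℂ (q₁ * q₂) :=
    DirichletCharacter.changeLevel (dvd_mul_right q₁ q₂) χ₁ *
      DirichletCharacter.changeLevel (dvd_mul_left q₂ q₁) χ₂
  have hψ : ∀ m : ℕ, ψ m = χ₁ m * χ₂ m := by
    intro m
    by_cases hm : Nat.Coprime m (q₁ * q₂)
    · have hm' : IsCoprime (m : ℤ) ((q₁ * q₂ : ℕ) : ℤ) := Nat.isCoprime_iff_coprime.2 hm
      have a1 := DirichletCharacter.changeLevel_eq_cast_of_dvd' χ₁ (dvd_mul_right q₁ q₂) hm'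
      have a2 := DirichletCharacter.changeLevel_eq_cast_of_dvd' χ₂ (dvd_mul_left q₂ q₁) hm'
      simp only [Int.cast_natCast] at a1 a2
      simp only [ψ, MulChar.mul_apply, a1, a2]
    · rw [MulChar.map_nonunit ψ (by rwa [ZMod.isUnit_iff_coprime])]
      rw [Nat.coprime_mul_iff_right, not_and_or] at hm
      rcases hm with hm | hm
      · rw [MulChar.map_nonunit χ₁ (by rwa [ZMod.isUnit_iff_coprime]), zero_mul]
      · rw [MulChar.map_nonunit χ₂ (by rwa [ZMod.isUnit_iff_coprime]), mul_zero]
  have h2 := DirichletCharacter.LSeries_ne_zero_of_one_lt_re ψ (s := 2) (by norm_num)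
  rw [LSeries] at h2
  have : (fun n : ℕ => LSeries.term (fun n => ψ n) 2 n) =
      (fun m : ℕ => 1 / (m : ℂ) ^ 2 * (χ₁ m * χ₂ m)) := by
    ext m
    rw [LSeries.term_def]
    split_ifs with h
    · subst h; simp
    · rw [hψ]
      norm_cast
      field_simp
  rw [show (∑' n : ℕ, LSeries.term (fun n => ψ n) 2 n) = A by rw [this]; exact hA.tsum_eq] at h2
  exact h2

lemma aux_D_ne {q₁ q₂ : ℕ} [NeZero q₁] [NeZero q₂]
    {χ₁ : DirichletCharacter ℂ q₁} {χ₂ : DirichletCharacter ℂ q₂}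
    (h₁ : χ₁.IsPrimitive) (h₂ : χ₂.IsPrimitive) (hpar : χ₁ (-1) * χ₂ (-1) = 1)
    (ε : ℤ) (hε : ε * ε = 1) :
    ∑ u ∈ Finset.range q₂, ∑ n ∈ Finset.range q₁,
      (starRingEnd ℂ) (χ₂ (u : ZMod q₂)) * (starRingEnd ℂ) (χ₁ (n : ZMod q₁)) *
      ((bernoulliFun 2 (Int.fract ((n : ℝ) / q₁ + ε * u / q₂)) : ℝ) : ℂ) ≠ 0 := by
  set W : ℂ := χ₂ ε * gaussSum χ₁⁻¹ ZMod.stdAddChar * gaussSum χ₂⁻¹ ZMod.stdAddChar with hW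
  have hW0 : W ≠ 0 := by
    refine mul_ne_zero (mul_ne_zero ?_ (aux_gauss_ne (aux_prim_inv h₁)))
      (aux_gauss_ne (aux_prim_inv h₂))
    intro h
    have : χ₂ ((ε : ZMod q₂) * ε) = 1 := by
      have : ((ε * ε : ℤ) : ZMod q₂) = 1 := by rw [hε]; simp
      rw [← Int.cast_mul, this, map_one]
    rw [map_mul, h] at this
    simp at this
  set D := ∑ u ∈ Finset.range q₂, ∑ n ∈ Finset.range q₁,
      (starRingEnd ℂ) (χ₂ (u : ZMod q₂)) * (starRingEnd ℂ) (χ₁ (n : ZMod q₁)) *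
      ((bernoulliFun 2 (Int.fract ((n : ℝ) / q₁ + ε * u / q₂)) : ℝ) : ℂ) with hD
  set K : ℂ := (-(2 * Real.pi * Complex.I) ^ 2 / (Nat.factorial 2 : ℕ)) with hK
  have key : HasSum (fun m : ℕ => 1 / (m : ℂ) ^ 2 * (χ₁ m * χ₂ m)) (K * D / (2 * W)) := by
    have s1 : HasSum (fun m : ℕ => ∑ u ∈ Finset.range q₂, ∑ n ∈ Finset.range q₁,
        ((starRingEnd ℂ) (χ₂ (u : ZMod q₂)) * (starRingEnd ℂ) (χ₁ (n : ZMod q₁))) *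
        ((1 : ℂ) / (m : ℂ) ^ 2 * (fourier (m : ℤ)
          ((Int.fract ((n : ℝ) / q₁ + ε * u / q₂) : ℝ) : UnitAddCircle) + 
          (-1 : ℂ) ^ 2 * fourier (-(m : ℤ))
          ((Int.fract ((n : ℝ) / q₁ + ε * u / q₂) : ℝ) : UnitAddCircle)))) 
        (∑ u ∈ Finset.range q₂, ∑ n ∈ Finset.range q₁,
        ((starRingEnd ℂ) (χ₂ (u : ZMod q₂)) * (starRingEnd ℂ) (χ₁ (n : ZMod q₁))) *
        (K * (bernoulliFun 2 (Int.fract ((n : ℝ) / q₁ + ε * u / q₂)) : ℝ))) := by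
      refine hasSum_sum fun u _ => hasSum_sum fun n _ => HasSum.mul_left _ ?_
      exact hasSum_one_div_nat_pow_mul_fourier le_rfl
        ⟨Int.fract_nonneg _, (Int.fract_lt_one _).le⟩
    have s2 := s1.mul_left (1 / (2 * W))
    convert! s2 using 1
    · ext m
      have d1 := aux_double h₁ h₂ (m : ℤ) ε
      have d2 := aux_double h₁ h₂ (-m : ℤ) ε
      rw [← hW] at d1 d2
      have : ∑ u ∈ Finset.range q₂, ∑ n ∈ Finset.range q₁,
        ((starRingEnd ℂ) (χ₂ (u : ZMod q₂)) * (starRingEnd ℂ) (χ₁ (n : ZMod q₁))) *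
        ((1 : ℂ) / (m : ℂ) ^ 2 * (fourier (m : ℤ)
          ((Int.fract ((n : ℝ) / q₁ + ε * u / q₂) : ℝ) : UnitAddCircle) + 
          (-1 : ℂ) ^ 2 * fourier (-(m : ℤ))
          ((Int.fract ((n : ℝ) / q₁ + ε * u / q₂) : ℝ) : UnitAddCircle))) = 
          1 / (m : ℂ) ^ 2 * (χ₁ (m : ℤ) * χ₂ (m : ℤ) * W + 
            χ₁ ((-m : ℤ) : ZMod q₁) * χ₂ ((-m : ℤ) : ZMod q₂) * W) := by
        rw [← d1, ← d2]
        simp only [← Finset.sum_add_distrib, Finset.mul_sum]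
        refine Finset.sum_congr rfl fun u _ => Finset.sum_congr rfl fun n _ => ?_
        ring
      rw [this]
      have p1 : χ₁ ((-m : ℤ) : ZMod q₁) = χ₁ (-1) * χ₁ m := by
        rw [← map_mul]; push_cast; ring_nf
      have p2 : χ₂ ((-m : ℤ) : ZMod q₂) = χ₂ (-1) * χ₂ m := by
        rw [← map_mul]; push_cast; ring_nf
      have : χ₁ ((-m : ℤ) : ZMod q₁) * χ₂ ((-m : ℤ) : ZMod q₂) = χ₁ m * χ₂ m := by
        rw [p1, p2]
        linear_combination (χ₁ m * χ₂ m) * hpar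
      rw [this]
      push_cast
      rw [← two_mul]
      generalize 1 / (m : ℂ) ^ 2 = z
      field_simp
    · rw [hD]
      simp only [Finset.mul_sum, Finset.sum_div]
      refine Finset.sum_congr rfl fun u _ => Finset.sum_congr rfl fun n _ => ?_
      ring
  have := aux_L_ne χ₁ χ₂ _ key
  intro h0
  rw [h0] at this
  simp at this

lemma aux_fract_div (M : ℤ) {N : ℕ} (hN : 0 < N) :
    Int.fract ((M : ℝ) / N) = ((M % N : ℤ) : ℝ) / N := by
  have hN' : (0 : ℝ) < N := by exact_mod_cast hN
  have hNz : (0 : ℤ) < N := by exact_mod_cast hN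
  have h0 : (0 : ℝ) ≤ ((M % N : ℤ) : ℝ) := by exact_mod_cast Int.emod_nonneg M hNz.ne'
  have h1 : ((M % N : ℤ) : ℝ) < N := by exact_mod_cast Int.emod_lt_of_pos M hNz
  rw [Int.fract_eq_iff]
  refine ⟨by positivity, by rwa [div_lt_one hN'], M / N, ?_⟩
  have h : (M : ℝ) = ((M % N : ℤ) : ℝ) + N * ((M / N : ℤ) : ℝ) := by
    exact_mod_cast (Int.emod_add_mul_ediv M N).symm
  rw [← sub_div, div_eq_iff hN'.ne']
  linear_combination h

lemma aux_B1 {N : ℕ} (hN : 0 < N) (M z : ℤ) (x δ : ℝ) (h0 : 0 < δ) (h1 : δ < 1 / N)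
    (hx : x = (M : ℝ) / N + δ + z) : B1 x = Int.fract ((M : ℝ) / N) + (δ - 1 / 2) := by
  have hN' : (0 : ℝ) < N := by exact_mod_cast hN
  have hNz : (0 : ℤ) < N := by exact_mod_cast hN
  have hf : Int.fract x = Int.fract ((M : ℝ) / N) + δ := by
    rw [Int.fract_eq_iff]
    refine ⟨by linarith [Int.fract_nonneg ((M : ℝ) / N)], ?_, ⌊(M : ℝ) / N⌋ + z, ?_⟩
    · rw [aux_fract_div M hN]
      have h2 : ((M % N : ℤ) : ℝ) ≤ N - 1 := by
        have := Int.emod_lt_of_pos M hNz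
        have : M % N ≤ N - 1 := by omega
        exact_mod_cast this
      have : ((M % N : ℤ) : ℝ) / N ≤ (N - 1) / N := by gcongr
      have e : ((N : ℝ) - 1) / N = 1 - 1 / N := by field_simp
      linarith
    · rw [hx, Int.fract]; push_cast; ring
  have := Int.fract_nonneg ((M : ℝ) / N)
  rw [B1, if_neg (by rw [hf]; linarith), hf]; ring

lemma aux_poly (a b c : ℝ) (n : ℕ) : ∑ k ∈ Finset.range n, (a * (k : ℝ) ^ 2 + b * k + c) =
    a * (n * (n - 1) * (2 * n - 1) / 6) + b * (n * (n - 1) / 2) + c * n := by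
  induction n with
  | zero => simp
  | succ n ih => rw [Finset.sum_range_succ, ih]; push_cast; ring

lemma aux_Q {N : ℕ} (hN : 0 < N) (t : ℤ) (d : ℝ) :
    ∑ k ∈ Finset.range N, ((k : ℝ) / N + d) * (Int.fract (((t + k : ℤ) : ℝ) / N) + d) =
      (∑ k ∈ Finset.range N, ((k : ℝ) / N + d) ^ 2 - N / 12) +
        N / 2 * bernoulliFun 2 (Int.fract ((t : ℝ) / N)) := by
  have hN' : (0 : ℝ) < N := by exact_mod_cast hN
  have hNz : (0 : ℤ) < N := by exact_mod_cast hN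
  obtain ⟨r, hr⟩ := Int.eq_ofNat_of_zero_le (Int.emod_nonneg t hNz.ne')
  have hrN : r < N := by
    have := Int.emod_lt_of_pos t hNz
    omega
  obtain ⟨m, rfl⟩ := Nat.exists_eq_add_of_lt hrN
  set N := r + m + 1 with hNdef
  have hft : Int.fract ((t : ℝ) / N) = (r : ℝ) / N := by
    rw [aux_fract_div t hN, hr]; simp
  have hfk : ∀ k : ℕ, Int.fract (((t + k : ℤ) : ℝ) / N) = (((r + k) % N : ℕ) : ℝ) / N := by
    intro k
    rw [aux_fract_div _ hN, Int.add_emod, hr]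
    norm_cast
    simp
  rw [hft, bernoulliFun_two]
  simp only [hfk]
  have hsplit : ∑ k ∈ Finset.range N, ((k : ℝ) / N + d) * ((((r + k) % N : ℕ) : ℝ) / N + d) =
      ∑ k ∈ Finset.range (m + 1), ((k : ℝ) / N + d) * ((r + k : ℝ) / N + d) +
      ∑ k ∈ Finset.range r, (((m + 1 + k : ℝ)) / N + d) * ((k : ℝ) / N + d) := by
    have : N = (m + 1) + r := by omega
    conv_lhs => rw [this, Finset.sum_range_add]
    rw [← this]
    congr 1
    · refine Finset.sum_congr rfl fun k hk => ?_
      rw [Finset.mem_range] at hk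
      rw [Nat.mod_eq_of_lt (by omega)]
      push_cast; rfl
    · refine Finset.sum_congr rfl fun k hk => ?_
      rw [Finset.mem_range] at hk
      have : (r + (m + 1 + k)) % N = k := by
        rw [show r + (m + 1 + k) = k + N by omega, Nat.add_mod_right, Nat.mod_eq_of_lt (by omega)]
      rw [this]; push_cast; rfl
  rw [hsplit]
  have e1 := aux_poly (1 / N ^ 2) (r / N ^ 2 + 2 * d / N) (d * (r / N + d)) (m + 1)
  have e2 := aux_poly (1 / N ^ 2) ((m + 1) / N ^ 2 + 2 * d / N) (d * ((m + 1) / N + d)) r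
  have e3 := aux_poly (1 / N ^ 2) (2 * d / N) (d ^ 2) N
  rw [show ∑ k ∈ Finset.range (m + 1), ((k : ℝ) / N + d) * ((r + k : ℝ) / N + d) = _ from
    (Finset.sum_congr rfl fun k _ => by ring).trans e1,
    show ∑ k ∈ Finset.range r, (((m + 1 + k : ℝ)) / N + d) * ((k : ℝ) / N + d) = _ from
    (Finset.sum_congr rfl fun k _ => by ring).trans e2,
    show ∑ k ∈ Finset.range N, ((k : ℝ) / N + d) ^ 2 = _ from
    (Finset.sum_congr rfl fun k _ => by ring).trans e3]
  have hNc : (N : ℝ) = r + m + 1 := by rw [hNdef]; push_cast; ring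
  have hm : (m : ℝ) = N - r - 1 := by linarith
  push_cast
  rw [hm]
  field_simp
  ring

lemma aux_sum_range_mul (a b : ℕ) (f : ℕ → ℂ) :
    ∑ j ∈ Finset.range (a * b), f j =
      ∑ x ∈ Finset.range a, ∑ y ∈ Finset.range b, f (y + b * x) := by
  induction a with
  | zero => simp
  | succ a ih =>
    rw [Finset.sum_range_succ, ← ih, Nat.succ_mul, Finset.sum_range_add]
    congr 1
    refine Finset.sum_congr rfl fun y _ => ?_
    rw [mul_comm a b, add_comm]

lemma aux_term {q₁ q₂ s : ℕ} (hq₁ : 0 < q₁) (hq₂ : 0 < q₂) (hs : 0 < s) (ε : ℤ)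
    (n u i k : ℕ) (hu0 : 0 < u) (hu : u < q₂) (hi : i < s) (hk : k < q₁ * q₂) :
    B1 (((u + q₂ * (i + s * k) : ℕ) : ℝ) / ((s * (q₁ * q₂) * q₂ : ℕ) : ℝ)) =
      (k : ℝ) / (q₁ * q₂ : ℕ) + (((u + q₂ * i : ℕ) : ℝ) / (s * (q₁ * q₂) * q₂ : ℕ) - 1 / 2) ∧
    B1 ((n : ℝ) / q₁ + (1 + ε * s * (q₁ * q₂)) * ((u + q₂ * (i + s * k) : ℕ) : ℝ) /
        ((s * (q₁ * q₂) * q₂ : ℕ) : ℝ)) =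
      Int.fract (((n * q₂ + ε * q₁ * u + k : ℤ) : ℝ) / (q₁ * q₂ : ℕ)) +
        (((u + q₂ * i : ℕ) : ℝ) / (s * (q₁ * q₂) * q₂ : ℕ) - 1 / 2) := by
  have hN : 0 < q₁ * q₂ := by positivity
  have r1 : (0 : ℝ) < q₁ := by exact_mod_cast hq₁
  have r2 : (0 : ℝ) < q₂ := by exact_mod_cast hq₂
  have rs : (0 : ℝ) < s := by exact_mod_cast hs
  have hδ0 : 0 < ((u + q₂ * i : ℕ) : ℝ) / (s * (q₁ * q₂) * q₂ : ℕ) := by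
    have : (0 : ℝ) < ((u + q₂ * i : ℕ) : ℝ) := by exact_mod_cast (by omega)
    positivity
  have hδ1 : ((u + q₂ * i : ℕ) : ℝ) / (s * (q₁ * q₂) * q₂ : ℕ) < 1 / (q₁ * q₂ : ℕ) := by
    have : u + q₂ * i < s * q₂ := by
      calc u + q₂ * i < q₂ + q₂ * i := by omega
        _ = (i + 1) * q₂ := by ring
        _ ≤ s * q₂ := Nat.mul_le_mul_right _ hi
    have h' : ((u + q₂ * i : ℕ) : ℝ) < s * q₂ := by exact_mod_cast this
    rw [div_lt_div_iff₀ (by positivity) (by positivity)]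
    have := mul_lt_mul_of_pos_right h' (mul_pos r1 r2)
    push_cast at *
    linarith
  constructor
  · rw [aux_B1 hN (k : ℤ) 0 _ _ hδ0 hδ1]
    · congr 1
      rw [aux_fract_div _ hN, Int.emod_eq_of_lt (by omega) (by exact_mod_cast hk)]
      simp
    · push_cast
      field_simp
      ring
  · rw [aux_B1 hN (n * q₂ + ε * q₁ * u + k : ℤ) (ε * (i + s * k)) _ _ hδ0 hδ1]
    push_cast
    field_simp
    ring

lemma aux_ne_one {q : ℕ} (hq : 1 < q) {χ : DirichletCharacter ℂ q} (h : χ.IsPrimitive) :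
    χ ≠ 1 := by
  have : NeZero q := ⟨by omega⟩
  rintro rfl
  rw [DirichletCharacter.isPrimitive_def, DirichletCharacter.conductor_one] at h
  omega

lemma aux_sum_zero {q : ℕ} (hq : 1 < q) {χ : DirichletCharacter ℂ q} (h : χ.IsPrimitive) :
    ∑ n ∈ Finset.range q, (starRingEnd ℂ) (χ (n : ZMod q)) = 0 := by
  have : NeZero q := ⟨by omega⟩
  rw [← map_sum, aux_sum_range_zmod (fun x => χ x),
    MulChar.sum_eq_zero_of_ne_one (aux_ne_one hq h), map_zero]

lemma aux_ded {q₁ q₂ : ℕ} (hq₁ : 1 < q₁) (hq₂ : 1 < q₂)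
    {χ₁ : DirichletCharacter ℂ q₁} {χ₂ : DirichletCharacter ℂ q₂}
    (h₁ : χ₁.IsPrimitive) (s : ℕ) (hs : 0 < s) (ε : ℤ) :
    ded χ₁ χ₂ (1 + ε * s * (q₁ * q₂)) ((s * (q₁ * q₂) * q₂ : ℕ) : ℤ) =
      (s : ℂ) * (((q₁ * q₂ : ℕ) : ℂ) / 2 *
    ∑ u ∈ Finset.range q₂, ∑ n ∈ Finset.range q₁,
      (starRingEnd ℂ) (χ₂ (u : ZMod q₂)) * (starRingEnd ℂ) (χ₁ (n : ZMod q₁)) *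
      ((bernoulliFun 2 (Int.fract ((n : ℝ) / q₁ + ε * u / q₂)) : ℝ) : ℂ)) := by
  have : Fact (1 < q₂) := ⟨hq₂⟩
  have hN : 0 < q₁ * q₂ := by positivity
  rw [ded, Int.toNat_natCast, mul_comm s (q₁ * q₂), aux_sum_range_mul, aux_sum_range_mul,
    Finset.sum_comm]
  have hi : ∀ i ∈ Finset.range s, (∑ k ∈ Finset.range (q₁ * q₂), ∑ u ∈ Finset.range q₂,
      ∑ n ∈ Finset.range q₁, (starRingEnd ℂ) (χ₂ ((u + q₂ * (i + s * k) : ℕ) : ZMod q₂)) *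
        (starRingEnd ℂ) (χ₁ (n : ZMod q₁)) *
        ((B1 (((u + q₂ * (i + s * k) : ℕ) : ℝ) / (((q₁ * q₂ * s * q₂ : ℕ) : ℤ) : ℝ)) *
          B1 ((n : ℝ) / (q₁ : ℝ) + ((1 + ε * s * (q₁ * q₂) : ℤ) : ℝ) *
          ((u + q₂ * (i + s * k) : ℕ) : ℝ) / (((q₁ * q₂ * s * q₂ : ℕ) : ℤ) : ℝ)) : ℝ) : ℂ)) =
      (((q₁ * q₂ : ℕ) : ℂ) / 2 *
    ∑ u ∈ Finset.range q₂, ∑ n ∈ Finset.range q₁,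
      (starRingEnd ℂ) (χ₂ (u : ZMod q₂)) * (starRingEnd ℂ) (χ₁ (n : ZMod q₁)) *
      ((bernoulliFun 2 (Int.fract ((n : ℝ) / q₁ + ε * u / q₂)) : ℝ) : ℂ)) := by
    intro i hi
    rw [Finset.mem_range] at hi
    rw [Finset.sum_comm, Finset.mul_sum]
    refine Finset.sum_congr rfl fun u hu => ?_
    rw [Finset.mem_range] at hu
    have hχ : ∀ k : ℕ, ((u + q₂ * (i + s * k) : ℕ) : ZMod q₂) = u := by intro k; simp
    simp only [hχ]
    rcases Nat.eq_zero_or_pos u with rfl | hu0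
    · have hz : χ₂ ((0 : ℕ) : ZMod q₂) = 0 := by
        rw [Nat.cast_zero]; exact MulChar.map_zero _
      simp only [hz, map_zero, zero_mul, Finset.sum_const_zero, mul_zero]
    rw [Finset.sum_comm]
    set d : ℝ := (((u + q₂ * i : ℕ) : ℝ) / (s * (q₁ * q₂) * q₂ : ℕ) - 1 / 2) with hd
    set R : ℝ := (∑ k ∈ Finset.range (q₁ * q₂), ((k : ℝ) / (q₁ * q₂ : ℕ) + d) ^ 2
      - (q₁ * q₂ : ℕ) / 12) with hR
    have hn : ∀ n ∈ Finset.range q₁, ∑ k ∈ Finset.range (q₁ * q₂),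
        (starRingEnd ℂ) (χ₂ (u : ZMod q₂)) *
        (starRingEnd ℂ) (χ₁ (n : ZMod q₁)) *
        ((B1 (((u + q₂ * (i + s * k) : ℕ) : ℝ) / (((q₁ * q₂ * s * q₂ : ℕ) : ℤ) : ℝ)) *
          B1 ((n : ℝ) / (q₁ : ℝ) + ((1 + ε * s * (q₁ * q₂) : ℤ) : ℝ) *
          ((u + q₂ * (i + s * k) : ℕ) : ℝ) / (((q₁ * q₂ * s * q₂ : ℕ) : ℤ) : ℝ)) : ℝ) : ℂ) =
        (starRingEnd ℂ) (χ₂ (u : ZMod q₂)) * R * (starRingEnd ℂ) (χ₁ (n : ZMod q₁)) +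
        ((q₁ * q₂ : ℕ) : ℂ) / 2 * ((starRingEnd ℂ) (χ₂ (u : ZMod q₂)) *
          (starRingEnd ℂ) (χ₁ (n : ZMod q₁)) *
      ((bernoulliFun 2 (Int.fract ((n : ℝ) / q₁ + ε * u / q₂)) : ℝ) : ℂ)) := by
      intro n _
      rw [← Finset.mul_sum, ← Complex.ofReal_sum]
      have hQ := aux_Q hN (n * q₂ + ε * q₁ * u) d
      rw [← hR] at hQ
      have hfr : (((n * q₂ + ε * q₁ * u : ℤ) : ℝ) / (q₁ * q₂ : ℕ)) =
          (n : ℝ) / q₁ + ε * u / q₂ := by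
        have r1 : (0 : ℝ) < q₁ := by exact_mod_cast (by omega)
        have r2 : (0 : ℝ) < q₂ := by exact_mod_cast (by omega)
        push_cast
        field_simp
      rw [hfr] at hQ
      have : ∑ k ∈ Finset.range (q₁ * q₂), 
        (B1 (((u + q₂ * (i + s * k) : ℕ) : ℝ) / (((q₁ * q₂ * s * q₂ : ℕ) : ℤ) : ℝ)) *
          B1 ((n : ℝ) / (q₁ : ℝ) + ((1 + ε * s * (q₁ * q₂) : ℤ) : ℝ) *
          ((u + q₂ * (i + s * k) : ℕ) : ℝ) / (((q₁ * q₂ * s * q₂ : ℕ) : ℤ) : ℝ))) =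
          R + (q₁ * q₂ : ℕ) / 2 * bernoulliFun 2 (Int.fract ((n : ℝ) / q₁ + ε * u / q₂)) := by
        rw [← hQ]
        refine Finset.sum_congr rfl fun k hk => ?_
        rw [Finset.mem_range] at hk
        obtain ⟨t1, t2⟩ := aux_term (q₁ := q₁) (q₂ := q₂) (by omega) (by omega) hs ε n u i k
          hu0 hu hi hk
        rw [← hd] at t1 t2
        rw [← t1, ← t2]
        rw [mul_comm (q₁ * q₂) s]
        push_cast
        rfl
      rw [this]
      push_cast
      ring
    rw [Finset.sum_congr rfl hn, Finset.sum_add_distrib, ← Finset.mul_sum,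
      aux_sum_zero hq₁ h₁, mul_zero, zero_add, Finset.mul_sum]
  rw [Finset.sum_congr rfl hi]
  simp

lemma aux_B1_neg (x : ℝ) : B1 (-x) = -B1 x := by
  by_cases h : Int.fract x = 0
  · have : Int.fract (-x) = 0 := Int.fract_neg_eq_zero.2 h
    simp [B1, h, this]
  · have h' : Int.fract (-x) ≠ 0 := fun h' => h (Int.fract_neg_eq_zero.1 h')
    rw [B1, B1, if_neg h, if_neg h', Int.fract_neg h]; ring

lemma aux_B1_add_int (x : ℝ) (z : ℤ) : B1 (x + z) = B1 x := by
  simp [B1]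

lemma aux_ded_neg {q₁ q₂ : ℕ} (hq₂ : 1 < q₂)
    (χ₁ : DirichletCharacter ℂ q₁) (χ₂ : DirichletCharacter ℂ q₂) (a : ℤ) (c : ℕ) (hc : 0 < c)
    (hd : q₂ ∣ c) :
    ded χ₁ χ₂ a c = -(starRingEnd ℂ) (χ₂ (-1)) * ded χ₁ χ₂ (-a) c := by
  have : Fact (1 < q₂) := ⟨hq₂⟩
  obtain ⟨c, rfl⟩ := Nat.exists_eq_succ_of_ne_zero hc.ne'
  rw [ded, ded, Int.toNat_natCast, Finset.sum_range_succ', Finset.sum_range_succ']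
  simp only [Nat.cast_zero, MulChar.map_zero, map_zero, zero_mul, Finset.sum_const_zero, add_zero]
  rw [← Finset.sum_range_reflect, Finset.mul_sum]
  refine Finset.sum_congr rfl fun j hj => ?_
  rw [Finset.mem_range] at hj
  rw [Finset.mul_sum]
  refine Finset.sum_congr rfl fun n _ => ?_
  have e : c - 1 - j + 1 = (c + 1) - (j + 1) := by omega
  have hle : j + 1 ≤ c + 1 := by omega
  have hz : ((c + 1 : ℕ) : ZMod q₂) = 0 := (ZMod.natCast_eq_zero_iff _ _).2 hd
  have hχ : χ₂ ((c - 1 - j + 1 : ℕ) : ZMod q₂) = χ₂ (-1) * χ₂ ((j + 1 : ℕ) : ZMod q₂) := by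
    rw [e, Nat.cast_sub hle, hz, ← map_mul]; congr 1; ring
  have hr : ((c - 1 - j + 1 : ℕ) : ℝ) = ((c + 1 : ℕ) : ℝ) - ((j + 1 : ℕ) : ℝ) := by
    rw [e, Nat.cast_sub hle]
  have hc0 : ((c + 1 : ℕ) : ℝ) ≠ 0 := by positivity
  simp only [Nat.succ_eq_add_one, Int.cast_natCast]
  rw [hχ, hr, map_mul]
  have b1 : B1 ((((c + 1 : ℕ) : ℝ) - ((j + 1 : ℕ) : ℝ)) / ((c + 1 : ℕ) : ℝ)) =
      - B1 (((j + 1 : ℕ) : ℝ) / ((c + 1 : ℕ) : ℝ)) := by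
    rw [← aux_B1_neg, ← aux_B1_add_int (-_) 1]
    congr 1
    push_cast at *
    field_simp
    ring
  have b2 : B1 ((n : ℝ) / q₁ + a * (((c + 1 : ℕ) : ℝ) - ((j + 1 : ℕ) : ℝ)) / ((c + 1 : ℕ) : ℝ)) =
      B1 ((n : ℝ) / q₁ + ((-a : ℤ) : ℝ) * ((j + 1 : ℕ) : ℝ) / ((c + 1 : ℕ) : ℝ)) := by
    rw [← aux_B1_add_int ((n : ℝ) / q₁ + ((-a : ℤ) : ℝ) * _ / _) a]
    congr 1
    rw [add_assoc]
    congr 1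
    push_cast at *
    field_simp
    ring
  rw [b1, b2]
  push_cast
  ring

/-- The parabolic family. -/
def auxMat (q₁ q₂ : ℕ) (t : ℤ) : SL(2, ℤ) :=
  ⟨!![1 - t * (q₁ * q₂), q₁ * t; -(t * (q₁ * q₂) * q₂), 1 + t * (q₁ * q₂)], by
    rw [Matrix.det_fin_two_of]; ring⟩

lemma auxMat_mul (q₁ q₂ : ℕ) (s t : ℤ) :
    auxMat q₁ q₂ s * auxMat q₁ q₂ t = auxMat q₁ q₂ (s + t) := by
  apply Subtype.ext
  rw [Matrix.SpecialLinearGroup.coe_mul]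
  ext i j
  fin_cases i <;> fin_cases j <;>
    simp [auxMat, Matrix.SpecialLinearGroup.coe_mul, Matrix.mul_apply, Fin.sum_univ_two] <;> ring

lemma auxMat_zero (q₁ q₂ : ℕ) : auxMat q₁ q₂ 0 = 1 := by
  ext i j
  fin_cases i <;> fin_cases j <;> simp [auxMat]

lemma auxMat_inv_mul (q₁ q₂ : ℕ) (s t : ℤ) :
    (auxMat q₁ q₂ s)⁻¹ * auxMat q₁ q₂ t = auxMat q₁ q₂ (t - s) := by
  rw [inv_mul_eq_iff_eq_mul, auxMat_mul]; congr 1; ring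

lemma auxMat_mem (q₁ q₂ : ℕ) (t : ℤ) : auxMat q₁ q₂ t ∈ Gamma1 (q₁ * q₂) := by
  have h : (q₁ : ZMod (q₁ * q₂)) * (q₂ : ZMod (q₁ * q₂)) = 0 := by
    rw [← Nat.cast_mul]; simp
  rw [Gamma1_mem]
  simp [auxMat, h]

lemma auxMat_neg {q₁ q₂ : ℕ} (hq₁ : 1 < q₁) (hq₂ : 1 < q₂)
    (χ₁ : DirichletCharacter ℂ q₁) (χ₂ : DirichletCharacter ℂ q₂) (s : ℕ) (hs : 0 < s) :
    dedSL χ₁ χ₂ (auxMat q₁ q₂ (-s)) =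
      ded χ₁ χ₂ (1 + (1 : ℤ) * s * (q₁ * q₂)) ((s * (q₁ * q₂) * q₂ : ℕ) : ℤ) := by
  have hp : (0 : ℤ) < s * (q₁ * q₂) * q₂ := by positivity
  rw [dedSL, if_pos (by simpa [auxMat] using hp)]
  congr 1 <;> simp [auxMat]

lemma auxMat_pos {q₁ q₂ : ℕ} (hq₁ : 1 < q₁) (hq₂ : 1 < q₂)
    (χ₁ : DirichletCharacter ℂ q₁) (χ₂ : DirichletCharacter ℂ q₂) (s : ℕ) (hs : 0 < s) :
    dedSL χ₁ χ₂ (auxMat q₁ q₂ s) =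
      ded χ₁ χ₂ (-(1 + (-1 : ℤ) * s * (q₁ * q₂))) ((s * (q₁ * q₂) * q₂ : ℕ) : ℤ) := by
  have hp : (0 : ℤ) < s * (q₁ * q₂) * q₂ := by positivity
  rw [dedSL, if_neg (by simpa [auxMat] using hp.le), if_pos (by simpa [auxMat] using hp)]
  congr 1 <;> simp [auxMat]
  ring

/-- The image of `Γ₁(q₁q₂)` under `S_{χ₁,χ₂}` is infinite; in particular the kernel
`K¹_{χ₁,χ₂}` has infinite index in `Γ₁(q₁q₂)` (there are infinitely many elements of
`Γ₁(q₁q₂)` lying in pairwise distinct cosets of the kernel). -/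
theorem image_infinite_and_kernel_infinite_index {q₁ q₂ : ℕ} (hq₁ : 1 < q₁) (hq₂ : 1 < q₂)
    (χ₁ : DirichletCharacter ℂ q₁) (χ₂ : DirichletCharacter ℂ q₂)
    (h₁ : χ₁.IsPrimitive) (h₂ : χ₂.IsPrimitive)
    (hpar : χ₁ (-1) * χ₂ (-1) = 1) :
    (dedSL χ₁ χ₂ '' {γ : SL(2, ℤ) | γ ∈ Gamma1 (q₁ * q₂)}).Infinite ∧
    ∃ f : ℕ → SL(2, ℤ), (∀ n, f n ∈ Gamma1 (q₁ * q₂)) ∧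
      ∀ m n, m ≠ n → dedSL χ₁ χ₂ ((f m)⁻¹ * f n) ≠ 0 := by
  have : NeZero q₁ := ⟨by omega⟩
  have : NeZero q₂ := ⟨by omega⟩
  have hN : (((q₁ * q₂ : ℕ) : ℂ) / 2) ≠ 0 :=
    div_ne_zero (Nat.cast_ne_zero.2 (by positivity)) two_ne_zero
  have D1 := mul_ne_zero hN (aux_D_ne h₁ h₂ hpar 1 (by norm_num))
  have D2 := mul_ne_zero hN (aux_D_ne h₁ h₂ hpar (-1) (by norm_num))
  have hpos : ∀ s : ℕ, 0 < s → dedSL χ₁ χ₂ (auxMat q₁ q₂ s) ≠ 0 := by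
    intro s hs
    rw [auxMat_pos hq₁ hq₂ χ₁ χ₂ s hs]
    intro h0
    have h3 := aux_ded_neg hq₂ χ₁ χ₂ (1 + (-1 : ℤ) * s * (q₁ * q₂)) (s * (q₁ * q₂) * q₂)
      (by positivity) (dvd_mul_left _ _)
    rw [h0, mul_zero, aux_ded hq₁ hq₂ h₁ s hs (-1)] at h3
    exact mul_ne_zero (Nat.cast_ne_zero.2 hs.ne') D2 h3
  have hneg : ∀ s : ℕ, 0 < s → dedSL χ₁ χ₂ (auxMat q₁ q₂ (-s)) ≠ 0 := by
    intro s hs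
    rw [auxMat_neg hq₁ hq₂ χ₁ χ₂ s hs, aux_ded hq₁ hq₂ h₁ s hs 1]
    exact mul_ne_zero (Nat.cast_ne_zero.2 hs.ne') D1
  refine ⟨?_, fun n => auxMat q₁ q₂ n, fun n => auxMat_mem _ _ _, ?_⟩
  · refine Set.infinite_of_injective_forall_mem
      (f := fun n : ℕ => dedSL χ₁ χ₂ (auxMat q₁ q₂ (-((n + 1 : ℕ) : ℤ)))) ?_
      (fun n => ⟨_, auxMat_mem _ _ _, rfl⟩)
    intro m n hmn
    simp only [auxMat_neg hq₁ hq₂ χ₁ χ₂ _ (Nat.succ_pos _),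
      aux_ded hq₁ hq₂ h₁ _ (Nat.succ_pos _) 1] at hmn
    have := mul_right_cancel₀ D1 hmn
    have := Nat.cast_injective this
    omega
  · intro m n hmn
    rw [auxMat_inv_mul]
    rcases lt_or_gt_of_ne hmn with h | h
    · have := hpos (n - m) (by omega)
      rwa [Nat.cast_sub h.le] at this
    · have := hneg (m - n) (by omega)
      rwa [Nat.cast_sub h.le, neg_sub] at this
end

section
/- For integers a, ā, c with c > 0, q₁q₂ | c, gcd(a, c) = 1, and a·ā ≡ 1 (mod c), one has S_{χ₁,χ₂}(ā, c) = χ₂(−1)·ψ(a)·S_{χ₁,χ₂}(a, c), where ψ = χ₁χ̄₂. -/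
open scoped MatrixGroups
open CongruenceSubgroup Matrix

/-- The character `ψ = χ₁ · χ̄₂` modulo `q₁ q₂`. -/
noncomputable def psiChar {q₁ q₂ : ℕ} (χ₁ : DirichletCharacter ℂ q₁)
    (χ₂ : DirichletCharacter ℂ q₂) : DirichletCharacter ℂ (q₁ * q₂) :=
  DirichletCharacter.changeLevel ⟨q₂, rfl⟩ χ₁ *
    DirichletCharacter.changeLevel ⟨q₁, mul_comm q₁ q₂⟩ (χ₂.ringHomComp (starRingEnd ℂ))


lemma B1_add_int (x : ℝ) (k : ℤ) : B1 (x + k) = B1 x := by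
  simp [B1]

/-- `B1 (x / N)` on residues. -/
noncomputable def bz (N : ℕ) (x : ZMod N) : ℝ := B1 ((x.val : ℝ) / N)

lemma bz_int (N : ℕ) [NeZero N] (k : ℤ) : bz N (k : ZMod N) = B1 ((k : ℝ) / N) := by
  have hN : (N : ℝ) ≠ 0 := Nat.cast_ne_zero.mpr (NeZero.ne N)
  have h : (((k : ZMod N).val : ℤ)) = k % N := ZMod.val_intCast k
  have h2 : (k : ℝ) = (((k : ZMod N).val : ℕ) : ℝ) + N * ((k / N : ℤ) : ℝ) := by
    have h3 := Int.emod_add_mul_ediv k N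
    rw [← h] at h3
    exact_mod_cast h3.symm
  rw [bz, h2, add_div, mul_div_cancel_left₀ _ hN, B1_add_int]

lemma sum_range_zmod (N : ℕ) [NeZero N] (f : ZMod N → ℂ) :
    ∑ j ∈ Finset.range N, f (j : ZMod N) = ∑ x : ZMod N, f x := by
  refine Finset.sum_bij' (fun j _ => (j : ZMod N)) (fun x _ => x.val) ?_ ?_ ?_ ?_ ?_
  · simp
  · intro x _
    simpa using ZMod.val_lt x
  · intro j hj
    exact ZMod.val_cast_of_lt (by simpa using hj)
  · intro x _
    simp
  · simp

/-- Multiplication by `M`, from `ZMod q` to `ZMod (q * M)`. -/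
noncomputable def scaleHom (q M N : ℕ) (h : N = q * M) : ZMod q →+ ZMod N :=
  ZMod.lift q ⟨zmultiplesHom (ZMod N) (M : ZMod N), by
    have : ((q * M : ℕ) : ZMod N) = 0 := by rw [← h]; simp
    simpa using this⟩

lemma scaleHom_int (q M N : ℕ) (h : N = q * M) (n : ℤ) :
    scaleHom q M N h (n : ZMod q) = (n : ZMod N) * (M : ZMod N) := by
  rw [scaleHom, ZMod.lift_coe]
  simp

lemma scaleHom_mul (q M N : ℕ) (h : N = q * M) (n : ℤ) (x : ZMod q) :
    scaleHom q M N h ((n : ZMod q) * x) = (n : ZMod N) * scaleHom q M N h x := by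
  obtain ⟨k, rfl⟩ := ZMod.intCast_surjective x
  rw [← Int.cast_mul, scaleHom_int, scaleHom_int]
  push_cast
  ring

lemma cast_scaleHom (q q' M N : ℕ) (h : N = q * M) (h' : q' ∣ M) (hN : q' ∣ N) (x : ZMod q) :
    ZMod.castHom hN (ZMod q') (scaleHom q M N h x) = 0 := by
  obtain ⟨k, rfl⟩ := ZMod.intCast_surjective x
  rw [scaleHom_int, map_mul, map_natCast, (ZMod.natCast_eq_zero_iff M q').mpr h', mul_zero]

lemma ded_eq {q₁ q₂ : ℕ} [NeZero q₁] (χ₁ : DirichletCharacter ℂ q₁)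
    (χ₂ : DirichletCharacter ℂ q₂) (a : ℤ) (M N : ℕ) [NeZero N] (h : N = q₁ * M)
    (hN : q₂ ∣ N) :
    ded χ₁ χ₂ a N = ∑ p : ZMod N × ZMod q₁,
      (starRingEnd ℂ) (χ₂ (ZMod.castHom hN (ZMod q₂) p.1)) * (starRingEnd ℂ) (χ₁ p.2) *
        ((bz N p.1 * bz N (scaleHom q₁ M N h p.2 + a * p.1) : ℝ) : ℂ) := by
  rw [Fintype.sum_prod_type, ← sum_range_zmod, ded, Int.toNat_natCast]
  refine Finset.sum_congr rfl fun j _ => ?_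
  rw [← sum_range_zmod]
  refine Finset.sum_congr rfl fun n _ => ?_
  have e1 : bz N (j : ZMod N) = B1 ((j : ℝ) / N) := by
    simpa using bz_int N j
  have e2 : bz N (scaleHom q₁ M N h (n : ZMod q₁) + a * (j : ZMod N))
      = B1 ((n : ℝ) / (q₁ : ℝ) + (a : ℝ) * (j : ℝ) / N) := by
    have e := scaleHom_int q₁ M N h n
    have e3 := bz_int N (n * M + a * j)
    push_cast at e e3
    rw [e, e3]
    congr 1
    have hq : (q₁ : ℝ) ≠ 0 := Nat.cast_ne_zero.mpr (NeZero.ne q₁)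
    have hM : (M : ℝ) ≠ 0 := by
      rintro h0
      have : M = 0 := by exact_mod_cast h0
      exact NeZero.ne N (by rw [h, this, mul_zero])
    rw [h]
    push_cast
    field_simp
  simp only [map_natCast]
  rw [e1, e2]
  simp

/-- `S_{χ₁,χ₂}(ā, c) = χ₂(−1) ψ(a) S_{χ₁,χ₂}(a, c)` where `aā ≡ 1 (mod c)`. -/
theorem ded_inv {q₁ q₂ : ℕ} (hq₁ : 1 < q₁) (hq₂ : 1 < q₂)
    (χ₁ : DirichletCharacter ℂ q₁) (χ₂ : DirichletCharacter ℂ q₂)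
    (h₁ : χ₁.IsPrimitive) (h₂ : χ₂.IsPrimitive)
    (hpar : χ₁ (-1) * χ₂ (-1) = 1)
    (a abar c : ℤ) (hc : 0 < c) (hdvd : ((q₁ * q₂ : ℕ) : ℤ) ∣ c) (hcop : IsCoprime a c)
    (hinv : a * abar ≡ 1 [ZMOD c]) :
    ded χ₁ χ₂ abar c = χ₂ (-1) * psiChar χ₁ χ₂ ((a : ZMod (q₁ * q₂))) *
      ded χ₁ χ₂ a c := by
  lift c to ℕ using hc.le with N
  have hNpos : 0 < N := by exact_mod_cast hc
  have : NeZero N := ⟨hNpos.ne'⟩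
  have : NeZero q₁ := ⟨by omega⟩
  have : NeZero q₂ := ⟨by omega⟩
  have hd : q₁ * q₂ ∣ N := by exact_mod_cast hdvd
  obtain ⟨t, ht⟩ := hd
  have h : N = q₁ * (q₂ * t) := by rw [ht, mul_assoc]
  have hN : q₂ ∣ N := ⟨q₁ * t, by rw [ht]; ring⟩
  have hN1 : q₁ ∣ N := ⟨_, h⟩
  have hi : (a : ZMod N) * (abar : ZMod N) = 1 := by
    have := (ZMod.intCast_eq_intCast_iff _ _ _).mpr hinv
    simpa using this
  have hi1 : (a : ZMod q₁) * (abar : ZMod q₁) = 1 := by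
    have := congrArg (ZMod.castHom hN1 (ZMod q₁)) hi
    simpa only [map_mul, map_intCast, map_one] using this
  have hi2 : (a : ZMod q₂) * (abar : ZMod q₂) = 1 := by
    have := congrArg (ZMod.castHom hN (ZMod q₂)) hi
    simpa only [map_mul, map_intCast, map_one] using this
  have hcopq : IsUnit (a : ZMod (q₁ * q₂)) := by
    have := congrArg (ZMod.castHom (⟨t, ht⟩ : q₁ * q₂ ∣ N) (ZMod (q₁ * q₂))) hi
    simp only [map_mul, map_intCast, map_one] at this
    exact IsUnit.of_mul_eq_one _ this
  have hpsi : psiChar χ₁ χ₂ (a : ZMod (q₁ * q₂))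
      = χ₁ (a : ZMod q₁) * (starRingEnd ℂ) (χ₂ (a : ZMod q₂)) := by
    obtain ⟨u, hu⟩ := hcopq
    rw [psiChar, MulChar.mul_apply, ← hu, DirichletCharacter.changeLevel_eq_cast_of_dvd,
      DirichletCharacter.changeLevel_eq_cast_of_dvd, hu, MulChar.ringHomComp_apply,
      ZMod.cast_intCast (Dvd.intro _ rfl), ZMod.cast_intCast (Dvd.intro_left _ rfl)]
  have hm : χ₁ (-1) = χ₂ (-1) := by
    have h2 : χ₂ (-1) * χ₂ (-1) = 1 := by rw [← map_mul]; simp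
    calc χ₁ (-1) = χ₁ (-1) * (χ₂ (-1) * χ₂ (-1)) := by rw [h2, mul_one]
      _ = (χ₁ (-1) * χ₂ (-1)) * χ₂ (-1) := by ring
      _ = _ := by rw [hpar, one_mul]
  have hmm : χ₁ (-1) * (starRingEnd ℂ) (χ₁ (-1)) = 1 := by
    have h2 : χ₁ (-1) * χ₁ (-1) = 1 := by rw [← map_mul]; simp
    rcases mul_self_eq_one_iff.mp h2 with h3 | h3 <;> rw [h3] <;> simp
  have hca : χ₁ (a : ZMod q₁) * (starRingEnd ℂ) (χ₁ (a : ZMod q₁)) = 1 := by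
    have hu : IsUnit (a : ZMod q₁) := IsUnit.of_mul_eq_one _ hi1
    obtain ⟨u, hu⟩ := hu
    rw [← hu, Complex.mul_conj, Complex.normSq_eq_norm_sq, DirichletCharacter.unit_norm_eq_one]
    simp
  rw [ded_eq χ₁ χ₂ abar _ N h hN, ded_eq χ₁ χ₂ a _ N h hN, hpsi, Finset.mul_sum]
  let e : ZMod N × ZMod q₁ ≃ ZMod N × ZMod q₁ :=
    { toFun := fun p => (scaleHom q₁ _ N h p.2 + abar * p.1, ((-a : ℤ) : ZMod q₁) * p.2)
      invFun := fun p => (scaleHom q₁ _ N h p.2 + a * p.1, ((-abar : ℤ) : ZMod q₁) * p.2)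
      left_inv := by
        rintro ⟨x, n⟩
        simp only [scaleHom_mul]
        push_cast
        ext
        · linear_combination x * hi
        · linear_combination n * hi1
      right_inv := by
        rintro ⟨x, n⟩
        simp only [scaleHom_mul]
        push_cast
        ext
        · linear_combination x * hi
        · linear_combination n * hi1 }
  refine Fintype.sum_equiv e _ _ ?_
  rintro ⟨x, n⟩
  have e1 : scaleHom q₁ _ N h (((-a : ℤ) : ZMod q₁) * n) + a * (scaleHom q₁ _ N h n + abar * x) = x := by
    rw [scaleHom_mul]
    push_cast
    linear_combination x * hi
  have e2 : ZMod.castHom hN (ZMod q₂) (scaleHom q₁ _ N h n + abar * x)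
      = abar * ZMod.castHom hN (ZMod q₂) x := by
    rw [map_add, cast_scaleHom q₁ q₂ _ N h ⟨t, rfl⟩ hN, map_mul, map_intCast, zero_add]
  have e3 : ((-a : ℤ) : ZMod q₁) * n = (-1) * (a * n) := by
    push_cast
    ring
  have e4 : χ₂ (a : ZMod q₂) * χ₂ (abar : ZMod q₂) = 1 := by
    rw [← map_mul, hi2, map_one]
  have e5 := congrArg (starRingEnd ℂ) e4
  rw [map_mul, map_one] at e5
  simp only [e, Equiv.coe_fn_mk]
  rw [e1, e2, e3, ← hm]
  simp only [map_mul χ₁, map_mul χ₂, map_mul (starRingEnd ℂ), Complex.ofReal_mul]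
  generalize (starRingEnd ℂ) (χ₁ n) = A at *
  generalize (starRingEnd ℂ) (χ₂ (ZMod.castHom hN (ZMod q₂) x)) = B at *
  generalize χ₁ (-1) = s1 at *
  generalize χ₁ (a : ZMod q₁) = s2 at *
  generalize (starRingEnd ℂ) (χ₂ (a : ZMod q₂)) = s3 at *
  generalize (starRingEnd ℂ) (χ₂ (abar : ZMod q₂)) = s4 at *
  generalize ((bz N x : ℝ) : ℂ) = X at *
  generalize ((bz N (scaleHom q₁ _ N h n + abar * x) : ℝ) : ℂ) = Y at *
  generalize (starRingEnd ℂ) s1 = s1' at *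
  generalize (starRingEnd ℂ) s2 = s2' at *
  calc B * A * (X * Y) = (s1 * s1') * (s2 * s2') * (s3 * s4) * (B * A * (X * Y)) := by
        rw [hmm, hca, e5]; ring
    _ = _ := by ring
end

section
/- Let σ : ℂ → ℂ be a ring homomorphism. Then for all integers a, c with c > 0, q₁q₂ | c, and gcd(a, c) = 1, one has σ(S_{χ₁,χ₂}(a, c)) = S_{χ₁^σ, χ₂^σ}(a, c), where χᵢ^σ denotes the primitive Dirichlet character n ↦ σ(χᵢ(n)) modulo qᵢ. -/
open scoped MatrixGroups
open CongruenceSubgroup Matrix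

theorem conj_sigma_aux {q : ℕ} (hq : 1 < q) (χ : DirichletCharacter ℂ q) (σ : ℂ →+* ℂ)
    (x : ZMod q) :
    σ ((starRingEnd ℂ) (χ x)) = (starRingEnd ℂ) ((χ.ringHomComp σ) x) := by
  haveI : NeZero q := ⟨by omega⟩
  have key : ∀ ψ : DirichletCharacter ℂ q, (starRingEnd ℂ) (ψ x) = (ψ x)⁻¹ := by
    intro ψ
    have h := MulChar.star_apply' ψ x
    rw [MulChar.inv_apply_eq_inv'] at h
    exact h
  rw [key, key, map_inv₀, MulChar.ringHomComp_apply]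

theorem B1_rat_aux (x : ℚ) : ∃ r : ℚ, B1 (x : ℝ) = (r : ℝ) := by
  unfold B1
  split_ifs
  · exact ⟨0, by simp⟩
  · exact ⟨Int.fract x - 1/2, by push_cast; rfl⟩

/-- Galois equivariance: `σ(S_{χ₁,χ₂}(a, c)) = S_{χ₁^σ,χ₂^σ}(a, c)` for any ring
homomorphism `σ : ℂ → ℂ`. -/
theorem ded_galois_equivariant {q₁ q₂ : ℕ} (hq₁ : 1 < q₁) (hq₂ : 1 < q₂)
    (χ₁ : DirichletCharacter ℂ q₁) (χ₂ : DirichletCharacter ℂ q₂)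
    (h₁ : χ₁.IsPrimitive) (h₂ : χ₂.IsPrimitive)
    (hpar : χ₁ (-1) * χ₂ (-1) = 1)
    (σ : ℂ →+* ℂ) (a c : ℤ) (hc : 0 < c) (hdvd : ((q₁ * q₂ : ℕ) : ℤ) ∣ c)
    (hcop : IsCoprime a c) :
    σ (ded χ₁ χ₂ a c) = ded (χ₁.ringHomComp σ) (χ₂.ringHomComp σ) a c := by 
  unfold ded
  simp only [map_sum, map_mul]
  refine Finset.sum_congr rfl fun j _ => Finset.sum_congr rfl fun n _ => ?_
  rw [conj_sigma_aux hq₁, conj_sigma_aux hq₂]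
  congr 1
  obtain ⟨r, hr⟩ := B1_rat_aux ((j : ℚ) / (c : ℚ))
  obtain ⟨s, hs⟩ := B1_rat_aux ((n : ℚ) / (q₁ : ℚ) + (a : ℚ) * (j : ℚ) / (c : ℚ))
  push_cast at hr hs
  rw [hr, hs]
  have h := map_ratCast σ (r * s)
  push_cast at h ⊢
  simpa using h
end
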